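/- For the metric ds² = 2 du dv + √(u v^{-3}) dv² + v² e^{g(x,y)}(dx² + dy²) on 0 < u,v < ∞, x,y ∈ ℝ, the vector field X with components X^a = (uv, v², 0, 0) is a proper projective vector field: (L_X g)_{ab;c} = 2g_{ab}ψ_c + g_{ac}ψ_b + g_{bc}ψ_a with projective 1-form ψ = dv (components (0,1,0,0)), which is nonzero. -/

import Mathlib

open scoped BigOperators

/-- Partial derivative in the `i`-th coordinate direction of a function on ℝ⁴. -/
noncomputable def pd (i : Fin 4) (f : (Fin 4 → ℝ) → ℝ) (q : Fin 4 → ℝ) : ℝ :=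
  fderiv ℝ f q (Pi.single i 1)

/-- Christoffel symbols `Γ^a_{bc}` of the Levi-Civita connection of the metric
field `g`. -/
noncomputable def christoffel (g : (Fin 4 → ℝ) → Matrix (Fin 4) (Fin 4) ℝ)
    (a b c : Fin 4) (q : Fin 4 → ℝ) : ℝ :=
  (1 / 2) * ∑ d, (g q)⁻¹ a d *
    (pd b (fun r => g r d c) q + pd c (fun r => g r d b) q - pd d (fun r => g r b c) q)

/-- Covariant derivative `ω_{a;b}` of a covector field `ω`. -/
noncomputable def covD1 (g : (Fin 4 → ℝ) → Matrix (Fin 4) (Fin 4) ℝ)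
    (ω : Fin 4 → (Fin 4 → ℝ) → ℝ) (a b : Fin 4) (q : Fin 4 → ℝ) : ℝ :=
  pd b (ω a) q - ∑ c, christoffel g c a b q * ω c q

/-- Covariant derivative `T_{ab;c}` of a (0,2) tensor field `T`. -/
noncomputable def covD2 (g : (Fin 4 → ℝ) → Matrix (Fin 4) (Fin 4) ℝ)
    (T : Fin 4 → Fin 4 → (Fin 4 → ℝ) → ℝ) (a b c : Fin 4) (q : Fin 4 → ℝ) : ℝ :=
  pd c (T a b) q - ∑ d, christoffel g d a c q * T d b q
    - ∑ d, christoffel g d b c q * T a d q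

/-- The metric `ds² = 2 du dv + √(u v⁻³) dv² + v² e^{g(x,y)} (dx² + dy²)` in
coordinates `(x¹,x²,x³,x⁴) = (u,v,x,y) = (q 0, q 1, q 2, q 3)`. -/
noncomputable def gmet (gf : ℝ → ℝ → ℝ) (q : Fin 4 → ℝ) :
    Matrix (Fin 4) (Fin 4) ℝ :=
  !![0, 1, 0, 0;
     1, Real.sqrt (q 0 / (q 1) ^ 3), 0, 0;
     0, 0, (q 1) ^ 2 * Real.exp (gf (q 2) (q 3)), 0;
     0, 0, 0, (q 1) ^ 2 * Real.exp (gf (q 2) (q 3))]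

/-- The vector field `l = ∂/∂u`, with components `l^a = (1,0,0,0)`. -/
def lvec : Fin 4 → ℝ := ![1, 0, 0, 0]

/-- The lowered covector field `l_a = g_{ab} l^b` associated to `l = ∂/∂u`. -/
noncomputable def llow (gf : ℝ → ℝ → ℝ) (a : Fin 4) (q : Fin 4 → ℝ) : ℝ :=
  ∑ b, gmet gf q a b * lvec b

/-- The vector field `X^a = (uv, v², 0, 0)`. -/
noncomputable def Xvec (q : Fin 4 → ℝ) : Fin 4 → ℝ := ![q 0 * q 1, (q 1) ^ 2, 0, 0]

/-- The lowered covector field `X_a = g_{ab} X^b`. -/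
noncomputable def Xlow (gf : ℝ → ℝ → ℝ) (a : Fin 4) (q : Fin 4 → ℝ) : ℝ :=
  ∑ b, gmet gf q a b * Xvec q b

/-- `h = L_X g`, i.e. `h_{ab} = X_{a;b} + X_{b;a}`. -/
noncomputable def hLie (gf : ℝ → ℝ → ℝ) (a b : Fin 4) (q : Fin 4 → ℝ) : ℝ :=
  covD1 (gmet gf) (Xlow gf) a b q + covD1 (gmet gf) (Xlow gf) b a q

/-- The projective 1-form `ψ = dv`, with components `(0,1,0,0)`. -/
def ψproj : Fin 4 → ℝ := ![0, 1, 0, 0]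

/-- The nontrivial function `√(u/v³)`. -/
noncomputable def Sf (r : Fin 4 → ℝ) : ℝ := Real.sqrt (r 0 / (r 1) ^ 3)

/-- The conformal factor `e^g`. -/
noncomputable def Ef (gf : ℝ → ℝ → ℝ) (r : Fin 4 → ℝ) : ℝ := Real.exp (gf (r 2) (r 3))

theorem pd_const' (i : Fin 4) (c : ℝ) (q : Fin 4 → ℝ) : pd i (fun _ => c) q = 0 := by
  simp [pd]

theorem pd_coord (i j : Fin 4) (q : Fin 4 → ℝ) :
    pd i (fun r => r j) q = if j = i then 1 else 0 := by
  have h : HasFDerivAt (fun r : Fin 4 → ℝ => r j)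
      (ContinuousLinearMap.proj (R := ℝ) (φ := fun _ : Fin 4 => ℝ) j) q :=
    hasFDerivAt_apply j q
  simp [pd, h.fderiv, Pi.single_apply]

theorem pd_add' (i : Fin 4) {f g : (Fin 4 → ℝ) → ℝ} {q : Fin 4 → ℝ}
    (hf : DifferentiableAt ℝ f q) (hg : DifferentiableAt ℝ g q) :
    pd i (fun r => f r + g r) q = pd i f q + pd i g q := by
  simp [pd, fderiv_fun_add hf hg]

theorem pd_mul' (i : Fin 4) {f g : (Fin 4 → ℝ) → ℝ} {q : Fin 4 → ℝ}
    (hf : DifferentiableAt ℝ f q) (hg : DifferentiableAt ℝ g q) :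
    pd i (fun r => f r * g r) q = f q * pd i g q + g q * pd i f q := by
  simp [pd, fderiv_fun_mul hf hg]

theorem pd_sq' (i : Fin 4) {f : (Fin 4 → ℝ) → ℝ} {q : Fin 4 → ℝ}
    (hf : DifferentiableAt ℝ f q) :
    pd i (fun r => f r ^ 2) q = 2 * f q * pd i f q := by
  simp only [pow_two]
  rw [pd_mul' i hf hf]; ring

theorem Sf_hasFDerivAt (q : Fin 4 → ℝ) (h0 : 0 < q 0) (h1 : 0 < q 1) :
    DifferentiableAt ℝ Sf q ∧ pd 0 Sf q = Sf q / (2 * q 0) ∧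
      pd 1 Sf q = - (3 * Sf q) / (2 * q 1) ∧ pd 2 Sf q = 0 ∧ pd 3 Sf q = 0 := by
  have hd : DifferentiableAt ℝ Sf q := by
    unfold Sf
    apply DifferentiableAt.sqrt
    · have hne : (q 1) ^ 3 ≠ 0 := by positivity
      have hn : DifferentiableAt ℝ (fun r : Fin 4 → ℝ => r 0) q := by fun_prop
      have hm : DifferentiableAt ℝ (fun r : Fin 4 → ℝ => r 1 ^ 3) q := by fun_prop
      simp only [div_eq_mul_inv]
      exact hn.fun_mul (hm.fun_inv hne)
    · positivity
  have hpos : 0 < Sf q := by unfold Sf; positivity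
  -- differentiate S² v³ = u
  have key : ∀ i, pd i (fun r => Sf r ^ 2 * (r 1 * r 1 ^ 2)) q = pd i (fun r => r 0) q := by
    intro i
    unfold pd
    congr 1
    apply Filter.EventuallyEq.fderiv_eq
    have e0 : ∀ᶠ r : Fin 4 → ℝ in nhds q, 0 < r 0 :=
      (continuous_apply 0).continuousAt.eventually (lt_mem_nhds h0)
    have e1 : ∀ᶠ r : Fin 4 → ℝ in nhds q, 0 < r 1 :=
      (continuous_apply 1).continuousAt.eventually (lt_mem_nhds h1)
    filter_upwards [e0, e1] with r hr0 hr1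
    unfold Sf
    rw [Real.sq_sqrt (by positivity)]
    field_simp
  have hS : Sf q ^ 2 * q 1 ^ 3 = q 0 := by
    unfold Sf
    rw [Real.sq_sqrt (by positivity)]
    field_simp
  have key2 : ∀ i, Sf q ^ 2 * (q 1 * (2 * q 1 * pd i (fun r => r 1) q)
      + q 1 ^ 2 * pd i (fun r => r 1) q) + (q 1 * q 1 ^ 2) * (2 * Sf q * pd i Sf q)
      = pd i (fun r => r 0) q := by
    intro i
    rw [← key i, pd_mul' i (by fun_prop) (by fun_prop), pd_mul' i (by fun_prop) (by fun_prop),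
      pd_sq' i hd, pd_sq' i (by fun_prop)]
  have k0 := key2 0
  have k1 := key2 1
  have k2 := key2 2
  have k3 := key2 3
  simp [pd_coord] at k0 k1 k2 k3
  refine ⟨hd, ?_, ?_, ?_, ?_⟩
  · rw [← hS]; field_simp; linear_combination k0
  · field_simp
    have : (Sf q * q 1 ^ 2) ≠ 0 := by positivity
    apply mul_left_cancel₀ this
    linear_combination k1
  · rcases k2 with h | h
    · exact absurd h h1.ne'
    · exact h.resolve_left hpos.ne'
  · rcases k3 with h | h
    · exact absurd h h1.ne'
    · exact h.resolve_left hpos.ne'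

theorem Ef_diff (gf : ℝ → ℝ → ℝ) (hgf : ContDiff ℝ (⊤ : ℕ∞) (fun p : ℝ × ℝ => gf p.1 p.2))
    (q : Fin 4 → ℝ) :
    DifferentiableAt ℝ (Ef gf) q ∧ pd 0 (Ef gf) q = 0 ∧ pd 1 (Ef gf) q = 0 := by
  have hg : Differentiable ℝ (fun p : ℝ × ℝ => gf p.1 p.2) := hgf.differentiable (by simp)
  have hG : Differentiable ℝ (fun p : ℝ × ℝ => Real.exp (gf p.1 p.2)) := hg.exp
  let L : (Fin 4 → ℝ) →L[ℝ] ℝ × ℝ :=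
    (ContinuousLinearMap.proj (R := ℝ) (φ := fun _ : Fin 4 => ℝ) 2).prod
      (ContinuousLinearMap.proj (R := ℝ) (φ := fun _ : Fin 4 => ℝ) 3)
  have h : HasFDerivAt (Ef gf) ((fderiv ℝ (fun p : ℝ × ℝ => Real.exp (gf p.1 p.2)) (L q)).comp L) q :=
    HasFDerivAt.comp q (hG (L q)).hasFDerivAt L.hasFDerivAt
  refine ⟨h.differentiableAt, ?_, ?_⟩ <;>
  · unfold pd
    rw [h.fderiv]
    simp [L]
    exact map_zero (fderiv ℝ (fun p : ℝ × ℝ => Real.exp (gf p.1 p.2)) (q 2, q 3))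

/-- Explicit inverse metric. -/
theorem gmet_inv (gf : ℝ → ℝ → ℝ) (q : Fin 4 → ℝ) (h1 : 0 < q 1) :
    (gmet gf q)⁻¹ = !![-Sf q, 1, 0, 0; 1, 0, 0, 0;
      0, 0, (q 1 ^ 2 * Ef gf q)⁻¹, 0; 0, 0, 0, (q 1 ^ 2 * Ef gf q)⁻¹] := by
  have hE : 0 < Ef gf q := Real.exp_pos _
  have hne : q 1 ^ 2 * Ef gf q ≠ 0 := by positivity
  apply Matrix.inv_eq_right_inv
  have hg : gmet gf q = !![0, 1, 0, 0; 1, Sf q, 0, 0; 0, 0, q 1 ^ 2 * Ef gf q, 0;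
      0, 0, 0, q 1 ^ 2 * Ef gf q] := rfl
  rw [hg]
  ext i j
  fin_cases i <;> fin_cases j <;> simp [Matrix.mul_apply, Fin.sum_univ_four] <;> field_simp

/-- First derivatives `∂_c g_{ab}` of the metric. -/
noncomputable def dgt (gf : ℝ → ℝ → ℝ) (q : Fin 4 → ℝ) (c : Fin 4) : Matrix (Fin 4) (Fin 4) ℝ :=
  let s : ℝ := pd c Sf q
  let e : ℝ := q 1 ^ 2 * pd c (Ef gf) q + Ef gf q * (2 * q 1 * (if 1 = c then 1 else 0))
  !![0, 0, 0, 0; 0, s, 0, 0; 0, 0, e, 0; 0, 0, 0, e]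

theorem pd_gmet (gf : ℝ → ℝ → ℝ) (hgf : ContDiff ℝ (⊤ : ℕ∞) (fun p : ℝ × ℝ => gf p.1 p.2))
    (q : Fin 4 → ℝ) (a b c : Fin 4) :
    pd c (fun r => gmet gf r a b) q = dgt gf q c a b := by
  have hE := (Ef_diff gf hgf q).1
  have hp : pd c (fun r => r 1 ^ 2 * Ef gf r) q =
      q 1 ^ 2 * pd c (Ef gf) q + Ef gf q * (2 * q 1 * (if 1 = c then 1 else 0)) := by
    rw [pd_mul' c (by fun_prop) hE, pd_sq' c (by fun_prop), pd_coord]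
  fin_cases a <;> fin_cases b <;> first
    | exact pd_const' c _ q
    | exact hp
    | rfl

/-- Explicit Christoffel symbols: `Gam a` is the symmetric matrix `Γ^a_{bc}`. -/
noncomputable def Gam (gf : ℝ → ℝ → ℝ) (q : Fin 4 → ℝ) : Fin 4 → Matrix (Fin 4) (Fin 4) ℝ :=
  let S := Sf q
  let Su := Sf q / (2 * q 0)
  let Sv := - (3 * Sf q) / (2 * q 1)
  let w := q 1 * Ef gf q
  let x := pd 2 (Ef gf) q / (2 * Ef gf q)
  let y := pd 3 (Ef gf) q / (2 * Ef gf q)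
  ![!![0, Su / 2, 0, 0; Su / 2, (Sv + S * Su) / 2, 0, 0; 0, 0, -w, 0; 0, 0, 0, -w],
    !![0, 0, 0, 0; 0, -Su / 2, 0, 0; 0, 0, 0, 0; 0, 0, 0, 0],
    !![0, 0, 0, 0; 0, 0, 1 / q 1, 0; 0, 1 / q 1, x, y; 0, 0, y, -x],
    !![0, 0, 0, 0; 0, 0, 0, 1 / q 1; 0, 0, -y, x; 0, 1 / q 1, x, y]]

theorem christoffel_gmet (gf : ℝ → ℝ → ℝ)
    (hgf : ContDiff ℝ (⊤ : ℕ∞) (fun p : ℝ × ℝ => gf p.1 p.2))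
    (q : Fin 4 → ℝ) (h0 : 0 < q 0) (h1 : 0 < q 1) (a b c : Fin 4) :
    christoffel (gmet gf) a b c q = Gam gf q a b c := by
  obtain ⟨-, s0, s1, s2, s3⟩ := Sf_hasFDerivAt q h0 h1
  obtain ⟨-, e0, e1⟩ := Ef_diff gf hgf q
  have hE : 0 < Ef gf q := Real.exp_pos _
  unfold christoffel
  rw [gmet_inv gf q h1]
  simp only [pd_gmet gf hgf]
  fin_cases a <;> fin_cases b <;> fin_cases c <;>
    simp [Fin.sum_univ_four, dgt, Gam, s0, s1, s2, s3, e0, e1] <;> field_simp <;> ring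

/-- Explicit `h = L_X g`. -/
noncomputable def hm (gf : ℝ → ℝ → ℝ) (a b : Fin 4) (q : Fin 4 → ℝ) : ℝ :=
  (!![0, 3 * q 1, 0, 0; 3 * q 1, 2 * q 0 + 3 * (q 1 * Sf q), 0, 0;
     0, 0, 2 * (q 1 * (q 1 ^ 2 * Ef gf q)), 0;
     0, 0, 0, 2 * (q 1 * (q 1 ^ 2 * Ef gf q))] : Matrix (Fin 4) (Fin 4) ℝ) a b

/-- Explicit lowered components of `X`. -/
theorem Xlow_eq (gf : ℝ → ℝ → ℝ) : Xlow gf =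
    ![fun r => r 1 ^ 2, fun r => r 0 * r 1 + Sf r * r 1 ^ 2, fun _ => 0, fun _ => 0] := by
  funext a q
  fin_cases a <;> simp [Xlow, Fin.sum_univ_four, gmet, Xvec, Sf]

theorem hLie_eq (gf : ℝ → ℝ → ℝ)
    (hgf : ContDiff ℝ (⊤ : ℕ∞) (fun p : ℝ × ℝ => gf p.1 p.2))
    (q : Fin 4 → ℝ) (h0 : 0 < q 0) (h1 : 0 < q 1) (a b : Fin 4) :
    hLie gf a b q = hm gf a b q := by
  obtain ⟨hS, s0, s1, s2, s3⟩ := Sf_hasFDerivAt q h0 h1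
  have p0 : ∀ c, pd c (fun r => r 1 ^ 2) q = 2 * q 1 * (if 1 = c then 1 else 0) := by
    intro c; rw [pd_sq' c (by fun_prop), pd_coord]
  have p1 : ∀ c, pd c (fun r => r 0 * r 1 + Sf r * r 1 ^ 2) q =
      q 0 * (if 1 = c then 1 else 0) + q 1 * (if 0 = c then 1 else 0) +
      (Sf q * (2 * q 1 * (if 1 = c then 1 else 0)) + q 1 ^ 2 * pd c Sf q) := by
    intro c
    rw [pd_add' c (by fun_prop) (by fun_prop), pd_mul' c (by fun_prop) (by fun_prop),
      pd_mul' c (by fun_prop) (by fun_prop), p0, pd_coord, pd_coord]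
  have hE : 0 < Ef gf q := Real.exp_pos _
  unfold hLie covD1
  simp only [christoffel_gmet gf hgf q h0 h1, Xlow_eq]
  fin_cases a <;> fin_cases b <;>
    simp [Fin.sum_univ_four, hm, Gam, s0, s1, s2, s3, p0, p1, pd_const'] <;> field_simp <;> ring

theorem pd_hLie (gf : ℝ → ℝ → ℝ)
    (hgf : ContDiff ℝ (⊤ : ℕ∞) (fun p : ℝ × ℝ => gf p.1 p.2))
    (q : Fin 4 → ℝ) (h0 : 0 < q 0) (h1 : 0 < q 1) (a b c : Fin 4) :
    pd c (hLie gf a b) q =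
      (let i0 : ℝ := if 0 = c then 1 else 0
       let i1 : ℝ := if 1 = c then 1 else 0
       let e : ℝ := 2 * (q 1 * (q 1 ^ 2 * pd c (Ef gf) q + Ef gf q * (2 * q 1 * i1))
          + q 1 ^ 2 * Ef gf q * i1)
       (!![0, 3 * i1, 0, 0; 3 * i1, 2 * i0 + 3 * (q 1 * pd c Sf q + Sf q * i1), 0, 0;
          0, 0, e, 0; 0, 0, 0, e] : Matrix (Fin 4) (Fin 4) ℝ)) a b := by
  have hS := (Sf_hasFDerivAt q h0 h1).1
  have hE := (Ef_diff gf hgf q).1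
  have e0 : ∀ᶠ r : Fin 4 → ℝ in nhds q, 0 < r 0 :=
    (continuous_apply 0).continuousAt.eventually (lt_mem_nhds h0)
  have e1 : ∀ᶠ r : Fin 4 → ℝ in nhds q, 0 < r 1 :=
    (continuous_apply 1).continuousAt.eventually (lt_mem_nhds h1)
  have hh : pd c (hLie gf a b) q = pd c (hm gf a b) q := by
    unfold pd
    congr 1
    apply Filter.EventuallyEq.fderiv_eq
    filter_upwards [e0, e1] with r hr0 hr1
    exact hLie_eq gf hgf r hr0 hr1 a b
  rw [hh]
  have hc : ∀ (k : ℝ) (f : (Fin 4 → ℝ) → ℝ), DifferentiableAt ℝ f q →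
      pd c (fun r => k * f r) q = k * pd c f q := by
    intro k f hf
    rw [pd_mul' c (by fun_prop) hf, pd_const']; ring
  have a1 : pd c (fun r => 3 * r 1) q = 3 * (if 1 = c then 1 else 0) := by
    rw [hc _ _ (by fun_prop), pd_coord]
  have a2 : pd c (fun r => 2 * r 0 + 3 * (r 1 * Sf r)) q = 2 * (if 0 = c then 1 else 0) +
      3 * (q 1 * pd c Sf q + Sf q * (if 1 = c then 1 else 0)) := by
    rw [pd_add' c (by fun_prop) (by fun_prop), hc _ _ (by fun_prop), hc _ _ (by fun_prop),
      pd_mul' c (by fun_prop) (by fun_prop), pd_coord, pd_coord]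
  have a3 : pd c (fun r => 2 * (r 1 * (r 1 ^ 2 * Ef gf r))) q =
      2 * (q 1 * (q 1 ^ 2 * pd c (Ef gf) q + Ef gf q * (2 * q 1 * (if 1 = c then 1 else 0)))
          + q 1 ^ 2 * Ef gf q * (if 1 = c then 1 else 0)) := by
    rw [hc _ _ (by fun_prop), pd_mul' c (by fun_prop) (by fun_prop),
      pd_mul' c (by fun_prop) (by fun_prop), pd_sq' c (by fun_prop), pd_coord]
  fin_cases a <;> fin_cases b <;> first
    | exact pd_const' c _ q
    | exact a1
    | exact a2
    | exact a3

/-- for the metric (10), `X^a = (uv, v², 0, 0)` is a proper projective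
vector field: `h_{ab;c} = 2g_{ab}ψ_c + g_{ac}ψ_b + g_{bc}ψ_a` with `h = L_X g` and
nonzero projective 1-form `ψ = dv`. -/
theorem X_proper_projective (gf : ℝ → ℝ → ℝ)
    (hgf : ContDiff ℝ (⊤ : ℕ∞) (fun p : ℝ × ℝ => gf p.1 p.2)) :
    (∀ (a b c : Fin 4) (q : Fin 4 → ℝ), 0 < q 0 → 0 < q 1 →
      covD2 (gmet gf) (hLie gf) a b c q =
        2 * gmet gf q a b * ψproj c + gmet gf q a c * ψproj b +
          gmet gf q b c * ψproj a) ∧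
    ψproj ≠ 0 := by
  refine ⟨?_, ?_⟩
  · intro a b c q h0 h1
    obtain ⟨-, s0, s1, s2, s3⟩ := Sf_hasFDerivAt q h0 h1
    obtain ⟨-, e0, e1⟩ := Ef_diff gf hgf q
    have hE : 0 < Ef gf q := Real.exp_pos _
    have hg : gmet gf q = !![0, 1, 0, 0; 1, Sf q, 0, 0; 0, 0, q 1 ^ 2 * Ef gf q, 0;
      0, 0, 0, q 1 ^ 2 * Ef gf q] := rfl
    unfold covD2
    rw [pd_hLie gf hgf q h0 h1, hg]
    simp only [christoffel_gmet gf hgf q h0 h1, hLie_eq gf hgf q h0 h1]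
    fin_cases a <;> fin_cases b <;> fin_cases c <;>
      simp [Fin.sum_univ_four, hm, Gam, ψproj, s0, s1, s2, s3, e0, e1] <;> field_simp <;> ring
  · intro h
    have := congrFun h 1
    simp [ψproj] at this
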